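/- Let k ≥ 2, s, s₁,…,s_k ∈ ℝ, and let M : ℝ^k → [0,∞) be a measurable multiplier of polynomial growth. Suppose there exist a nonempty proper subset A of {0,1,…,k}, measurable M₁, M₂ : ℝ^k → [0,∞), C₀ > 0 and θ ∈ (0,1) such that (M₁M₂)^{1/2} = M · ⟨ξ⟩^{s} / ∏_{j=1}^k ⟨ξ_j⟩^{s_j} pointwise (ξ = ξ₁+⋯+ξ_k identified with ξ₀), and for all K > 0: S_A(M₁,K) + S_{Aᶜ}(M₂,K) ≤ C₀ K^{θ}, where S_B(M′,K) is the supremum over α ∈ ℝ and fixed ξ_j, j ∉ B, of the integral of M′ · 1_{|Φ−α| < K} over the variables ξ_j, j ∈ B, constrained to ξ₀ = ξ₁+⋯+ξ_k, and Φ = ξ₀³ − ξ₁³ − ⋯ − ξ_k³. Then there exist b ∈ (1/2,1), b′ ∈ (b−1,0) and C > 0 such that for every K > 0 and all Schwartz functions v₁,…,v_k on ℝ²: ‖(M·1_{|Φ| < K})^∨(v₁,…,v_k)‖_{X^{s,b′}} ≤ C K^{θ} ∏_{j=1}^k ‖v_j‖_{X^{s_j,b}}. -/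

import Mathlib

open MeasureTheory

noncomputable section

/-- Spacetime Fourier transform on ℝ². -/
def FT2 (u : ℝ × ℝ → ℂ) (τ ξ : ℝ) : ℂ :=
  ∫ p : ℝ × ℝ, Complex.exp (-(Complex.I * ((p.1 * τ + p.2 * ξ : ℝ) : ℂ))) * u p

/-- Bourgain weight ⟨ξ⟩^{2s}⟨τ-ξ³⟩^{2b}, with ⟨x⟩ = (1+x²)^{1/2}. -/
def wgt (s b τ ξ : ℝ) : ℝ := (1 + ξ ^ 2) ^ s * (1 + (τ - ξ ^ 3) ^ 2) ^ b

/-- The Bourgain norm ‖u‖_{X^{s,b}}. -/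
def Xnorm (s b : ℝ) (u : ℝ × ℝ → ℂ) : ℝ :=
  Real.sqrt (∫ q : ℝ × ℝ, wgt s b q.1 q.2 * ‖FT2 u q.1 q.2‖ ^ 2)

/-- Extend `k-1` frequencies to `k` with the last determined by the total `tot`. -/
def padTot (k : ℕ) (tot : ℝ) (v : Fin (k - 1) → ℝ) : Fin k → ℝ :=
  fun j => if h : (j : ℕ) < k - 1 then v ⟨j, h⟩ else tot - ∑ i, v i

/-- Spacetime Fourier transform of M^∨(u₁,…,u_k) at (τ,ξ). -/
def convFT (k : ℕ) (M : (Fin k → ℝ) → ℂ) (u : Fin k → ℝ × ℝ → ℂ) (τ ξ : ℝ) : ℂ :=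
  ∫ q : Fin (k - 1) → ℝ × ℝ,
    M (padTot k ξ fun i => (q i).2) *
      ∏ j, FT2 (u j) (padTot k τ (fun i => (q i).1) j) (padTot k ξ (fun i => (q i).2) j)

/-- The Bourgain norm ‖M^∨(u₁,…,u_k)‖_{X^{s,b}}. -/
def XnormM (s b : ℝ) (k : ℕ) (M : (Fin k → ℝ) → ℂ) (u : Fin k → ℝ × ℝ → ℂ) : ℝ :=
  Real.sqrt (∫ q : ℝ × ℝ, wgt s b q.1 q.2 * ‖convFT k M u q.1 q.2‖ ^ 2)

/-- The variables (ξ₁,…,ξ_k) of a full vector (ξ₀,ξ₁,…,ξ_k). -/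
def tailVec (k : ℕ) (η : Fin (k + 1) → ℝ) : Fin k → ℝ := fun i => η i.succ

/-- The resonance function Φ = ξ₀³ − ξ₁³ − ⋯ − ξ_k³. -/
def PhiFull (k : ℕ) (η : Fin (k + 1) → ℝ) : ℝ := (η 0) ^ 3 - ∑ i : Fin k, (η i.succ) ^ 3

/-- Replace the `j₀` coordinate of `v` so that the constraint ξ₀ = ξ₁+⋯+ξ_k holds. -/
def completeAt (k : ℕ) (j₀ : Fin (k + 1)) (v : Fin (k + 1) → ℝ) : Fin (k + 1) → ℝ :=
  Function.update v j₀
    (if j₀ = 0 then ∑ i : Fin k, v i.succ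
     else v 0 - ∑ i : Fin k, if i.succ = j₀ then 0 else v i.succ)

/-- Build the full frequency vector: coordinates outside `B` are fixed by `g`, the
coordinates in `B` other than `j₀` are the free variables `h`, and the `j₀` coordinate is
determined by the hyperplane constraint ξ₀ = ξ₁+⋯+ξ_k. -/
def buildVec (k : ℕ) (B : Finset (Fin (k + 1))) (j₀ : Fin (k + 1))
    (g : Fin (k + 1) → ℝ) (h : {j // j ∈ B.erase j₀} → ℝ) : Fin (k + 1) → ℝ :=
  completeAt k j₀ (fun j => if hj : j ∈ B.erase j₀ then h ⟨j, hj⟩ else g j)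

/-- The frequency-restricted bound S_B(M',K) ≤ C₀ K^θ: for every K > 0, α ∈ ℝ, every
parametrization of the constrained set and all fixed outside variables, the affine integral
of M'·1_{|Φ−α|<K} over the variables in `B` is at most C₀ K^θ. -/
def FreqRestricted (k : ℕ) (M' : (Fin k → ℝ) → ℝ) (B : Finset (Fin (k + 1)))
    (C₀ θ : ℝ) : Prop :=
  ∀ K : ℝ, 0 < K → ∀ α : ℝ, ∀ j₀ ∈ B, ∀ g : Fin (k + 1) → ℝ,
    (∫⁻ h : {j // j ∈ B.erase j₀} → ℝ,
        ENNReal.ofReal (M' (tailVec k (buildVec k B j₀ g h)) *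
          (if |PhiFull k (buildVec k B j₀ g h) - α| < K then 1 else 0)))
      ≤ ENNReal.ofReal (C₀ * K ^ θ)

/-- The resonance function in the free variables: Φ = (ξ₁+⋯+ξ_k)³ − ξ₁³ − ⋯ − ξ_k³. -/
def PhiK (k : ℕ) (ξ : Fin k → ℝ) : ℝ := (∑ j, ξ j) ^ 3 - ∑ j, (ξ j) ^ 3

open Finset in
/-- The vector agreeing with `v` off `j₀` and satisfying `w 0 = w 1 + ⋯ + w k`, over a general
additive group. -/
def completeGen {E : Type*} [AddCommGroup E] {k : ℕ} (j₀ : Fin (k + 1)) (v : Fin (k + 1) → E) :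
    Fin (k + 1) → E :=
  Function.update v j₀
    (if j₀ = 0 then ∑ i : Fin k, v i.succ
     else v 0 - ∑ i : Fin k, if i.succ = j₀ then 0 else v i.succ)

section Complete

variable {E : Type*} [AddCommGroup E] {k : ℕ}

lemma completeGen_of_ne {j₀ i : Fin (k + 1)} (h : i ≠ j₀) (v : Fin (k + 1) → E) :
    completeGen j₀ v i = v i := by
  simp [completeGen, h]

lemma completeGen_eq {j₀ : Fin (k + 1)} {v w : Fin (k + 1) → E} (h : ∀ i, i ≠ j₀ → w i = v i)
    (hw : w 0 = ∑ i : Fin k, w i.succ) : completeGen j₀ v = w := by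
  ext i
  by_cases hi : i = j₀
  · subst hi
    rw [completeGen, Function.update_self]
    split_ifs with h0
    · subst h0
      rw [hw]
      exact Finset.sum_congr rfl fun l _ => (h _ (Fin.succ_ne_zero l)).symm
    · obtain ⟨m, rfl⟩ := Fin.exists_succ_eq.mpr h0
      rw [← h 0 (Fin.succ_ne_zero m).symm, hw, sub_eq_iff_eq_add]
      have : ∀ l : Fin k, (if l.succ = m.succ then 0 else v l.succ)
          = w l.succ - if l = m then w l.succ else 0 := by
        intro l
        by_cases hl : l = m
        · simp [hl]
        · simp [hl, h l.succ (by simpa using hl)]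
      simp_rw [this, Finset.sum_sub_distrib]
      simp
  · rw [completeGen_of_ne hi, h i hi]

lemma completeGen_zero_eq_sum (j₀ : Fin (k + 1)) (v : Fin (k + 1) → E) :
    completeGen j₀ v 0 = ∑ i : Fin k, completeGen j₀ v i.succ := by
  by_cases h0 : j₀ = 0
  · subst h0
    simp [completeGen]
  · obtain ⟨m, rfl⟩ := Fin.exists_succ_eq.mpr h0
    have : ∀ l : Fin k, completeGen m.succ v l.succ
        = (if l.succ = m.succ then 0 else v l.succ)
          + if l = m then completeGen m.succ v m.succ else 0 := by
      intro l
      by_cases hl : l = m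
      · simp [hl]
      · rw [completeGen_of_ne (by simpa using hl)]
        simp [hl]
    rw [Finset.sum_congr rfl fun l _ => this l, Finset.sum_add_distrib,
      completeGen_of_ne (Fin.succ_ne_zero m).symm]
    simp [completeGen]

lemma measurable_completeGen [MeasurableSpace E] [MeasurableAdd₂ E] [MeasurableSub₂ E]
    (j₀ : Fin (k + 1)) : Measurable (completeGen j₀ : (Fin (k + 1) → E) → _) := by
  refine measurable_pi_lambda _ fun i => ?_
  by_cases hi : i = j₀
  · subst hi
    simp only [completeGen, Function.update_self]
    split_ifs with h0
    · fun_prop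
    · refine (measurable_pi_apply 0).sub (Finset.measurable_sum _ fun l _ => ?_)
      split_ifs <;> fun_prop
  · simp only [completeGen_of_ne hi]
    fun_prop

/-- Along the constraint, coordinate `j` depends on coordinate `i` by translation or reflection. -/
lemma completeGen_update (i j : Fin (k + 1)) (hij : i ≠ j) (y : Fin (k + 1) → E) :
    ∃ c : E, (∀ t, completeGen j (Function.update y i t) j = c + t) ∨
      (∀ t, completeGen j (Function.update y i t) j = c - t) := by
  have hsum : ∀ (m : Fin k) (t : E),
      ∑ l : Fin k, (Pi.single m.succ t : Fin (k + 1) → E) l.succ = t := by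
    intro m t
    simp [Pi.single_apply]
  have hsum0 : ∀ t : E, ∑ l : Fin k, (Pi.single 0 t : Fin (k + 1) → E) l.succ = 0 := by
    intro t
    simp
  have key : ∀ (t u : E), (Pi.single i t + Pi.single j u : Fin (k + 1) → E) 0
      = ∑ l : Fin k, (Pi.single i t + Pi.single j u : Fin (k + 1) → E) l.succ →
      completeGen j (Function.update y i t) j = completeGen j (Function.update y i 0) j + u := by
    intro t u h
    rw [completeGen_eq (w := completeGen j (Function.update y i 0)
      + (Pi.single i t + Pi.single j u))]
    · simp [hij.symm]
    · intro l hl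
      by_cases hli : l = i
      · subst hli
        simp [completeGen_of_ne hl, hl]
      · simp [completeGen_of_ne hl, hl, hli]
    · rw [Pi.add_apply, h, completeGen_zero_eq_sum, ← Finset.sum_add_distrib]
      rfl
  refine ⟨completeGen j (Function.update y i 0) j, ?_⟩
  rcases Fin.eq_zero_or_eq_succ i with rfl | ⟨m, rfl⟩
  · obtain ⟨n, rfl⟩ := Fin.exists_succ_eq.mpr hij.symm
    exact Or.inl fun t => key t t (by simp [hsum])
  · rcases Fin.eq_zero_or_eq_succ j with rfl | ⟨n, rfl⟩
    · exact Or.inl fun t => key t t (by simp [hsum])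
    · exact Or.inr fun t => by
        rw [sub_eq_add_neg]
        exact key t (-t) (by simp only [Pi.add_apply, Finset.sum_add_distrib, hsum]; simp)

lemma completeGen_update_swap (i j : Fin (k + 1)) (hij : i ≠ j) (y : Fin (k + 1) → E) (t : E) :
    completeGen i (Function.update y j (completeGen j (Function.update y i t) j))
      = completeGen j (Function.update y i t) := by
  refine completeGen_eq (fun l hl => ?_) (completeGen_zero_eq_sum _ _)
  by_cases hlj : l = j
  · subst hlj
    simp
  · simp [completeGen_of_ne hlj, hl, hlj]

open Function in
/-- The measure on the hyperplane does not depend on which coordinate is eliminated. -/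
lemma lmarginal_completeGen_swap [MeasureSpace E] [SigmaFinite (volume : Measure E)]
    [MeasurableAdd₂ E] [MeasurableNeg E] [MeasurableSub₂ E]
    [(volume : Measure E).IsAddLeftInvariant]
    [(volume : Measure E).IsNegInvariant] {i j : Fin (k + 1)} (hij : i ≠ j)
    {s : Finset (Fin (k + 1))} (hi : i ∉ s) (hj : j ∉ s) {H : (Fin (k + 1) → E) → ENNReal}
    (hH : Measurable H) :
    lmarginal (fun _ => (volume : Measure E)) (insert i s) (H ∘ completeGen j)
      = lmarginal (fun _ => (volume : Measure E)) (insert j s) (H ∘ completeGen i) := by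
  rw [lmarginal_insert' _ (hH.comp (measurable_completeGen j)) hi,
    lmarginal_insert' _ (hH.comp (measurable_completeGen i)) hj]
  congr 1
  funext y
  simp only [comp_apply]
  set G : E → ENNReal := fun u => H (completeGen i (update y j u)) with hG
  have h1 : ∀ t, H (completeGen j (update y i t)) = G (completeGen j (update y i t) j) := by
    intro t
    rw [hG]
    simp only
    rw [completeGen_update_swap i j hij]
  simp_rw [h1]
  obtain ⟨c, hc | hc⟩ := completeGen_update i j hij y
  · simp_rw [hc]
    exact lintegral_add_left_eq_self G c
  · simp_rw [hc]
    exact lintegral_sub_left_eq_self G c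

end Complete

section Marginal

open ENNReal

lemma lmarginal_prod {ι X : Type*} [DecidableEq ι] [MeasureSpace X]
    [SigmaFinite (volume : Measure X)] (s : Finset ι) (f : ι → X → ℝ≥0∞)
    (hf : ∀ i, Measurable (f i)) (x : ι → X) :
    lmarginal (fun _ => (volume : Measure X)) s (fun x => ∏ j ∈ s, f j (x j)) x
      = ∏ j ∈ s, ∫⁻ t, f j t := by
  induction s using Finset.induction_on with
  | empty => simp
  | insert i s hi ih =>
    have hm : ∀ s : Finset ι, Measurable fun x : ι → X => ∏ j ∈ s, f j (x j) := fun s =>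
      Finset.measurable_prod _ fun j _ => (hf j).comp (measurable_pi_apply j)
    rw [lmarginal_insert' _ (hm _) hi, Finset.prod_insert hi, ← ih]
    have : ∀ x : ι → X, ∫⁻ t, ∏ j ∈ insert i s, f j (Function.update x i t j)
        = (∫⁻ t, f i t) * ∏ j ∈ s, f j (x j) := by
      intro x
      rw [← lintegral_mul_const _ (hf i)]
      refine lintegral_congr fun t => ?_
      rw [Finset.prod_insert hi, Function.update_self]
      congr 1
      refine Finset.prod_congr rfl fun j hj => ?_
      rw [Function.update_of_ne (ne_of_mem_of_not_mem hj hi)]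
    simp_rw [this]
    exact lintegral_const_mul _ ((hm s).comp measurable_updateFinset)

lemma lintegral_pi_prod {ι X : Type*} [Fintype ι] [MeasureSpace X]
    [SigmaFinite (volume : Measure X)] (f : ι → X → ℝ≥0∞) (hf : ∀ i, Measurable (f i)) :
    ∫⁻ x : ι → X, ∏ j, f j (x j) = ∏ j, ∫⁻ t, f j t := by
  classical
  rcases isEmpty_or_nonempty (ι → X) with h | ⟨⟨x⟩⟩
  · obtain ⟨i, hi⟩ : ∃ i : ι, IsEmpty X := by
      by_contra! hc
      exact h.elim fun i => (hc i).some
    rw [lintegral_of_isEmpty, Finset.prod_eq_zero (Finset.mem_univ i) (lintegral_of_isEmpty _ _)]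
  · rw [← lmarginal_prod Finset.univ f hf x, lmarginal_univ]
    rfl

/-- Integrating over the variables in `B` at fixed outside variables by the frequency-restricted
bound, then over the variables in `s`. -/
lemma lmarginal_block_le {k : ℕ} {B s : Finset (Fin (k + 1))} {j₀ : Fin (k + 1)} (hj₀ : j₀ ∈ B)
    (hs : Disjoint B s) {N : (Fin (k + 1) → ℝ) → ℝ≥0∞} (hN : Measurable N) {D c : ℝ≥0∞}
    (hD : ∀ g, ∫⁻ h : {j // j ∈ B.erase j₀} → ℝ, N (buildVec k B j₀ g h) ≤ D)
    {f : Fin (k + 1) → ℝ × ℝ → ℝ≥0∞} (hf : ∀ j, Measurable (f j))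
    {W : ℝ × ℝ → ℝ≥0∞} (hW : Measurable W) (hc : ∀ ξ, ∫⁻ τ, W (τ, ξ) ≤ c)
    (x : Fin (k + 1) → ℝ × ℝ) :
    lmarginal (fun _ => (volume : Measure (ℝ × ℝ))) (B.erase j₀ ∪ s)
      ((fun x => N (fun j => (x j).2) * (∏ j ∈ s, f j (x j)) * ∏ j ∈ B.erase j₀, W (x j))
        ∘ completeGen j₀) x
      ≤ D * c ^ (B.erase j₀).card * ∏ j ∈ s, ∫⁻ p, f j p := by
  set T := B.erase j₀ with hT
  have hj₀s : j₀ ∉ s := Finset.disjoint_left.mp hs hj₀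
  have hTs : Disjoint T s := Finset.disjoint_of_subset_left (Finset.erase_subset _ _) hs
  have hfm : Measurable fun x : Fin (k + 1) → ℝ × ℝ => ∏ j ∈ s, f j (x j) :=
    Finset.measurable_prod _ fun j _ => (hf j).comp (measurable_pi_apply j)
  have hF : Measurable fun x : Fin (k + 1) → ℝ × ℝ =>
      N (fun j => (x j).2) * (∏ j ∈ s, f j (x j)) * ∏ j ∈ T, W (x j) :=
    ((hN.comp (by fun_prop)).mul hfm).mul
      (Finset.measurable_prod _ fun j _ => hW.comp (measurable_pi_apply j))
  rw [lmarginal_union' _ _ (hF.comp (measurable_completeGen j₀)) hTs]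
  have hmem : ∀ (y : Fin (k + 1) → ℝ × ℝ) (z : T → ℝ × ℝ) (i : T),
      completeGen j₀ (Function.updateFinset y T z) i = z i := fun y z i => by
    rw [completeGen_of_ne (Finset.ne_of_mem_erase i.2)]
    simp [Function.updateFinset]
  have hnot : ∀ (y : Fin (k + 1) → ℝ × ℝ) (z : T → ℝ × ℝ), ∀ j ∈ s,
      completeGen j₀ (Function.updateFinset y T z) j = y j := fun y z j hj => by
    rw [completeGen_of_ne (ne_of_mem_of_not_mem hj hj₀s)]
    simp [Function.updateFinset, Finset.disjoint_right.mp hTs hj]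
  have hsnd : ∀ (y : Fin (k + 1) → ℝ × ℝ) (z : T → ℝ × ℝ),
      (fun j => (completeGen j₀ (Function.updateFinset y T z) j).2)
        = buildVec k B j₀ (fun j => (y j).2) (fun i => (z i).2) := by
    intro y z
    refine (completeGen_eq (E := ℝ) (j₀ := j₀) (fun i hi => ?_) ?_).symm
    · rw [completeGen_of_ne hi, Function.updateFinset]
      split_ifs <;> rfl
    · rw [completeGen_zero_eq_sum, Prod.snd_sum]
  have hbm : ∀ g, Measurable fun h : T → ℝ => buildVec k B j₀ g h := fun g => by
    refine (measurable_completeGen (E := ℝ) j₀).comp (measurable_pi_lambda _ fun j => ?_)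
    split_ifs <;> fun_prop
  have hinner : ∀ y, lmarginal (fun _ => (volume : Measure (ℝ × ℝ))) T
      ((fun x => N (fun j => (x j).2) * (∏ j ∈ s, f j (x j)) * ∏ j ∈ T, W (x j))
        ∘ completeGen j₀) y ≤ (D * c ^ T.card) * ∏ j ∈ s, f j (y j) := by
    intro y
    set g : Fin (k + 1) → ℝ := fun j => (y j).2
    set Q : (T → ℝ) × (T → ℝ) → ℝ≥0∞ := fun p =>
      N (buildVec k B j₀ g p.2) * ∏ i, W (p.1 i, p.2 i) with hQ
    have hQm : Measurable Q := (hN.comp ((hbm g).comp measurable_snd)).mul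
      (Finset.measurable_prod _ fun i _ => hW.comp (by fun_prop))
    have hQle : ∫⁻ p, Q p ≤ D * c ^ T.card := by
      rw [Measure.volume_eq_prod, lintegral_prod_symm _ hQm.aemeasurable]
      calc ∫⁻ h, ∫⁻ t, Q (t, h) ≤ ∫⁻ h, N (buildVec k B j₀ g h) * c ^ T.card := by
            refine lintegral_mono fun h => ?_
            simp only [hQ]
            have hWm : Measurable fun t : T → ℝ => ∏ i, W (t i, h i) :=
              Finset.measurable_prod _ fun i _ => hW.comp (by fun_prop)
            rw [lintegral_const_mul _ hWm, lintegral_pi_prod (fun i τ => W (τ, h i))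
              fun i => hW.comp (by fun_prop)]
            gcongr
            calc ∏ i : T, ∫⁻ τ, W (τ, h i) ≤ ∏ _i : T, c := Finset.prod_le_prod' fun i _ => hc _
              _ = c ^ T.card := by simp
        _ = (∫⁻ h, N (buildVec k B j₀ g h)) * c ^ T.card :=
            lintegral_mul_const _ (hN.comp (hbm g))
        _ ≤ D * c ^ T.card := by gcongr; exact hD g
    calc (lmarginal (fun _ => (volume : Measure (ℝ × ℝ))) T
      ((fun x => N (fun j => (x j).2) * (∏ j ∈ s, f j (x j)) * ∏ j ∈ T, W (x j))
        ∘ completeGen j₀) y)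
        = ∫⁻ z : T → ℝ × ℝ,
          Q (MeasurableEquiv.arrowProdEquivProdArrow ℝ ℝ T z) * ∏ j ∈ s, f j (y j) := by
          refine lintegral_congr fun z => ?_
          simp only [Function.comp_apply, hQ]
          rw [hsnd, Finset.prod_congr rfl fun j hj => by rw [hnot y z j hj],
            ← Finset.prod_coe_sort T]
          simp_rw [hmem]
          rw [mul_right_comm]
          rfl
      _ = (∫⁻ z : T → ℝ × ℝ, Q (MeasurableEquiv.arrowProdEquivProdArrow ℝ ℝ T z))
          * ∏ j ∈ s, f j (y j) :=
          lintegral_mul_const _ (hQm.comp (MeasurableEquiv.measurable _))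
      _ = (∫⁻ p, Q p) * ∏ j ∈ s, f j (y j) := by
          rw [(volume_measurePreserving_arrowProdEquivProdArrow ℝ ℝ T).lintegral_comp hQm]
      _ ≤ _ := by gcongr
  refine (lmarginal_mono hinner x).trans_eq ?_
  rw [← lmarginal_prod s f hf x]
  exact lintegral_const_mul _ (hfm.comp measurable_updateFinset)

/-- The point of the hyperplane `p₀ = p₁ + ⋯ + p_k` given by the `padTot` parametrization. -/
def hyperplanePoint {n : ℕ} (p : ℝ × ℝ) (q : Fin n → ℝ × ℝ) : Fin (n + 2) → ℝ × ℝ :=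
  Fin.cons p fun j => (padTot (n + 1) p.1 (fun i => (q i).1) j,
    padTot (n + 1) p.2 (fun i => (q i).2) j)

lemma measurable_uncurry_hyperplanePoint {n : ℕ} :
    Measurable fun z : (ℝ × ℝ) × (Fin n → ℝ × ℝ) => hyperplanePoint z.1 z.2 := by
  refine measurable_pi_lambda _ fun j => ?_
  refine Fin.cases ?_ (fun j => ?_) j
  · simpa [hyperplanePoint] using measurable_fst
  · simp only [hyperplanePoint, Fin.cons_succ, padTot]
    refine Measurable.prodMk ?_ ?_ <;> split_ifs <;> fun_prop

lemma measurable_hyperplanePoint {n : ℕ} (p : ℝ × ℝ) :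
    Measurable (hyperplanePoint p : (Fin n → ℝ × ℝ) → _) :=
  measurable_uncurry_hyperplanePoint.comp measurable_prodMk_left

lemma hyperplanePoint_zero_eq_sum {n : ℕ} (p : ℝ × ℝ) (q : Fin n → ℝ × ℝ) :
    hyperplanePoint p q 0 = ∑ j : Fin (n + 1), hyperplanePoint p q j.succ := by
  simp [hyperplanePoint, Fin.sum_univ_castSucc, padTot, Prod.ext_iff, Prod.fst_sum, Prod.snd_sum]

/-- Integrals over the `padTot` parametrization of the hyperplane are marginals. -/
lemma lintegral_padTot {n : ℕ} {H : (Fin (n + 2) → ℝ × ℝ) → ℝ≥0∞} (hH : Measurable H)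
    (x : Fin (n + 2) → ℝ × ℝ) :
    lmarginal (fun _ => (volume : Measure (ℝ × ℝ))) (Finset.univ \ {0, Fin.last (n + 1)})
        (H ∘ completeGen (Fin.last (n + 1))) x
      = ∫⁻ q : Fin n → ℝ × ℝ, H (hyperplanePoint (x 0) q) := by
  set e : Fin n → Fin (n + 2) := fun i => i.castSucc.succ with he
  have hinj : Function.Injective e := fun a b h => by simpa [he] using h
  set G : (Fin n → ℝ × ℝ) → ℝ≥0∞ := fun q => H (hyperplanePoint (x 0) q) with hG
  have hGm : Measurable G := hH.comp (measurable_hyperplanePoint _)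
  have hset : (Finset.univ \ {0, Fin.last (n + 1)} : Finset (Fin (n + 2)))
      = Finset.univ.image e := by
    ext j
    simp only [Finset.mem_sdiff, Finset.mem_univ, true_and, Finset.mem_insert,
      Finset.mem_singleton, Finset.mem_image, he]
    constructor
    · intro h
      push Not at h
      obtain ⟨m, rfl⟩ := Fin.exists_succ_eq.mpr h.1
      refine ⟨m.castPred fun hm => h.2 (by simp [hm]), by simp⟩
    · rintro ⟨a, rfl⟩
      simp [Fin.ext_iff]
      omega
  have hx : lmarginal (fun _ => (volume : Measure (ℝ × ℝ)))
      (Finset.univ \ {0, Fin.last (n + 1)}) (H ∘ completeGen (Fin.last (n + 1))) x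
      = lmarginal (fun _ => (volume : Measure (ℝ × ℝ)))
      (Finset.univ \ {0, Fin.last (n + 1)}) (G ∘ fun y i => y (e i)) x := by
    refine lintegral_congr fun z => ?_
    set y := Function.updateFinset x _ z with hy
    have hy0 : y 0 = x 0 := by simp [hy, Function.updateFinset]
    simp only [Function.comp_apply, hG]
    congr 1
    refine completeGen_eq (fun i hi => ?_) (hyperplanePoint_zero_eq_sum _ _)
    refine Fin.cases (fun _ => by simp [hyperplanePoint, hy0]) (fun j hj => ?_) i hi
    have hjn : (j : ℕ) < n := by
      have := j.2
      rw [← Fin.succ_last, Ne, Fin.succ_inj, Fin.ext_iff, Fin.val_last] at hj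
      omega
    simp [hyperplanePoint, padTot, hjn, he]
  rw [hx, hset]
  refine (lmarginal_image (μ := fun _ => (volume : Measure (ℝ × ℝ))) hinj Finset.univ hGm x).trans
    ?_
  rw [lmarginal_univ]
  rfl

lemma lmarginal_erase_completeGen {k : ℕ} {U : Finset (Fin (k + 1))} {i j : Fin (k + 1)}
    (hi : i ∈ U) (hj : j ∈ U) {H : (Fin (k + 1) → ℝ × ℝ) → ℝ≥0∞} (hH : Measurable H) :
    lmarginal (fun _ => (volume : Measure (ℝ × ℝ))) (U.erase i) (H ∘ completeGen i)
      = lmarginal (fun _ => (volume : Measure (ℝ × ℝ))) (U.erase j) (H ∘ completeGen j) := by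
  rcases eq_or_ne i j with rfl | hij
  · rfl
  · have h := lmarginal_completeGen_swap hij (s := (U.erase i).erase j) (by simp) (by simp) hH
    rw [Finset.insert_erase (by simp [hij.symm, hj]), Finset.erase_right_comm,
      Finset.insert_erase (by simp [hij, hi])] at h
    exact h.symm

lemma lintegral_hyperplane_le {n : ℕ} {A : Finset (Fin (n + 2))} (h0 : 0 ∉ A) {j₀ : Fin (n + 2)}
    (hj₀ : j₀ ∈ A) {N : (Fin (n + 2) → ℝ) → ℝ≥0∞} (hN : Measurable N) {D c : ℝ≥0∞}
    (hD : ∀ g, ∫⁻ h : {j // j ∈ A.erase j₀} → ℝ, N (buildVec (n + 1) A j₀ g h) ≤ D)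
    {f : Fin (n + 2) → ℝ × ℝ → ℝ≥0∞} (hf : ∀ j, Measurable (f j))
    {W : ℝ × ℝ → ℝ≥0∞} (hW : Measurable W) (hc : ∀ ξ, ∫⁻ τ, W (τ, ξ) ≤ c) {H}
    (hH : Measurable H)
    (hH_def : H = fun x : Fin (n + 2) → ℝ × ℝ => N (fun j => (x j).2)
      * (∏ j ∈ Aᶜ.erase 0, f j (x j)) * ∏ j ∈ A.erase j₀, W (x j)) (p : ℝ × ℝ) :
    ∫⁻ q : Fin n → ℝ × ℝ, H (hyperplanePoint p q)
      ≤ D * c ^ (A.erase j₀).card * ∏ j ∈ Aᶜ.erase 0, ∫⁻ p, f j p := by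
  have hj₀0 : j₀ ≠ 0 := ne_of_mem_of_not_mem hj₀ h0
  have hdisj : Disjoint A (Aᶜ.erase 0) :=
    Finset.disjoint_of_subset_right (Finset.erase_subset _ _) disjoint_compl_right
  rw [← lintegral_padTot hH fun _ => p]
  have hset : (Finset.univ \ {0, Fin.last (n + 1)} : Finset (Fin (n + 2)))
      = (Finset.univ.erase 0).erase (Fin.last (n + 1)) := by
    ext j
    simp [and_comm]
  have hset' : (Finset.univ.erase 0).erase j₀ = A.erase j₀ ∪ Aᶜ.erase 0 := by
    ext j
    have : j = j₀ → j ∈ A := fun h => h ▸ hj₀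
    have : j = 0 → j ∉ A := fun h => h ▸ h0
    simp only [Finset.mem_erase, Finset.mem_univ, Finset.mem_union, Finset.mem_compl]
    tauto
  rw [hset, lmarginal_erase_completeGen (j := j₀) (by simp) (by simp [hj₀0]) hH, hset', hH_def]
  exact lmarginal_block_le hj₀ hdisj hN hD hf hW hc _

lemma lintegral_lintegral_hyperplane_le {n : ℕ} {A : Finset (Fin (n + 2))} (h0 : 0 ∉ A)
    {N : (Fin (n + 2) → ℝ) → ℝ≥0∞} (hN : Measurable N) {D c : ℝ≥0∞}
    (hD : ∀ g, ∫⁻ h : {j // j ∈ Aᶜ.erase 0} → ℝ, N (buildVec (n + 1) Aᶜ 0 g h) ≤ D)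
    {f : Fin (n + 2) → ℝ × ℝ → ℝ≥0∞} (hf : ∀ j, Measurable (f j))
    {W : ℝ × ℝ → ℝ≥0∞} (hW : Measurable W) (hc : ∀ ξ, ∫⁻ τ, W (τ, ξ) ≤ c) {H}
    (hH : Measurable H)
    (hH_def : H = fun x : Fin (n + 2) → ℝ × ℝ => N (fun j => (x j).2)
      * (∏ j ∈ A, f j (x j)) * ∏ j ∈ Aᶜ.erase 0, W (x j)) :
    ∫⁻ p, ∫⁻ q : Fin n → ℝ × ℝ, H (hyperplanePoint p q)
      ≤ D * c ^ (Aᶜ.erase 0).card * ∏ j ∈ A, ∫⁻ p, f j p := by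
  have hins : insert 0 (Finset.univ \ {0, Fin.last (n + 1)} : Finset (Fin (n + 2)))
      = Finset.univ.erase (Fin.last (n + 1)) := by
    ext j
    have : (0 : Fin (n + 2)) ≠ Fin.last (n + 1) := Fin.last_pos.ne
    simp only [Finset.mem_insert, Finset.mem_sdiff, Finset.mem_univ, Finset.mem_singleton,
      Finset.mem_erase]
    grind
  have hset' : Finset.univ.erase 0 = Aᶜ.erase 0 ∪ A := by
    ext j
    have : j = 0 → j ∉ A := fun h => h ▸ h0
    simp only [Finset.mem_erase, Finset.mem_univ, Finset.mem_union, Finset.mem_compl]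
    tauto
  set x : Fin (n + 2) → ℝ × ℝ := 0
  calc ∫⁻ p, ∫⁻ q : Fin n → ℝ × ℝ, H (hyperplanePoint p q)
      = ∫⁻ p, (lmarginal (fun _ => (volume : Measure (ℝ × ℝ)))
          (Finset.univ \ {0, Fin.last (n + 1)}) (H ∘ completeGen (Fin.last (n + 1))))
          (Function.update x 0 p) := by
        refine lintegral_congr fun p => ?_
        rw [lintegral_padTot hH, Function.update_self]
    _ = (lmarginal (fun _ => (volume : Measure (ℝ × ℝ))) (Aᶜ.erase 0 ∪ A)
          (H ∘ completeGen 0)) x := by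
        refine (lmarginal_insert (μ := fun _ => volume) _
          (hH.comp (measurable_completeGen (Fin.last (n + 1)))) (i := 0)
          (s := Finset.univ \ {0, Fin.last (n + 1)}) (by simp) x).symm.trans ?_
        rw [hins, lmarginal_erase_completeGen (j := 0) (by simp) (by simp) hH, hset']
    _ ≤ _ := by
        rw [hH_def]
        exact lmarginal_block_le (by simpa using h0) disjoint_compl_left hN hD hf hW hc _

lemma sq_lintegral_le {α : Type*} [MeasurableSpace α] {μ : Measure α} {Y F G : α → ℝ≥0∞}
    (hF : Measurable F) (hG : Measurable G) (h : ∀ a, Y a ^ 2 ≤ F a * G a) :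
    (∫⁻ a, Y a ∂μ) ^ 2 ≤ (∫⁻ a, F a ∂μ) * ∫⁻ a, G a ∂μ := by
  have hsq : ∀ a : ℝ≥0∞, (a ^ (1 / 2 : ℝ)) ^ 2 = a := fun a => by
    rw [← ENNReal.rpow_natCast, ← ENNReal.rpow_mul]
    norm_num
  have hY : ∀ a, Y a ≤ F a ^ (1 / 2 : ℝ) * G a ^ (1 / 2 : ℝ) := fun a => by
    rw [← ENNReal.mul_rpow_of_nonneg _ _ (by norm_num)]
    refine (ENNReal.pow_le_pow_left_iff two_ne_zero).mp ?_
    rw [hsq]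
    exact h a
  calc (∫⁻ a, Y a ∂μ) ^ 2
      ≤ ((∫⁻ a, F a ∂μ) ^ (1 / 2 : ℝ) * (∫⁻ a, G a ∂μ) ^ (1 / 2 : ℝ)) ^ 2 := by
        gcongr
        exact (lintegral_mono hY).trans (ENNReal.lintegral_mul_norm_pow_le hF.aemeasurable
          hG.aemeasurable (by norm_num) (by norm_num) (by norm_num))
    _ = _ := by rw [mul_pow, hsq, hsq]

lemma prod_mul_prod_compl_erase_zero {R : Type*} [CommMonoid R] {k : ℕ}
    {A : Finset (Fin (k + 1))} (h0 : 0 ∉ A) (g : Fin (k + 1) → R) :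
    (∏ j ∈ A, g j) * ∏ j ∈ Aᶜ.erase 0, g j = ∏ j : Fin k, g j.succ := by
  have hset : A ∪ Aᶜ.erase 0 = Finset.univ.image Fin.succ := by
    ext j
    have : j = 0 → j ∉ A := fun h => h ▸ h0
    simp only [Fin.image_succ_univ, Finset.mem_erase, Finset.mem_singleton, Finset.mem_union,
      Finset.mem_compl]
    tauto
  rw [← Finset.prod_union (Finset.disjoint_of_subset_right (Finset.erase_subset _ _)
    disjoint_compl_right), hset, Finset.prod_image fun a _ b _ h => Fin.succ_injective _ h]

/-- The multilinear estimate for a kernel controlled pointwise by two multipliers that satisfy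
frequency-restricted bounds on complementary blocks. -/
lemma lintegral_sq_hyperplane_le {n : ℕ} {A : Finset (Fin (n + 2))} (hA : A.Nonempty)
    (h0 : 0 ∉ A) {N₁ N₂ : (Fin (n + 2) → ℝ) → ℝ≥0∞} (hN₁ : Measurable N₁) (hN₂ : Measurable N₂)
    {D c : ℝ≥0∞} (hc1 : 1 ≤ c)
    (hD₁ : ∀ j₀ ∈ A, ∀ g, ∫⁻ h : {j // j ∈ A.erase j₀} → ℝ,
      N₁ (buildVec (n + 1) A j₀ g h) ≤ D)
    (hD₂ : ∀ j₀ ∈ Aᶜ, ∀ g, ∫⁻ h : {j // j ∈ Aᶜ.erase j₀} → ℝ,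
      N₂ (buildVec (n + 1) Aᶜ j₀ g h) ≤ D)
    {f : Fin (n + 2) → ℝ × ℝ → ℝ≥0∞} (hf : ∀ j, Measurable (f j))
    {W : ℝ × ℝ → ℝ≥0∞} (hW : Measurable W) (hW1 : ∀ p, W p ≤ 1)
    (hc : ∀ ξ, ∫⁻ τ, W (τ, ξ) ≤ c)
    {Y : ℝ × ℝ → (Fin n → ℝ × ℝ) → ℝ≥0∞}
    (hY : ∀ p q, Y p q ^ 2 ≤ N₁ (fun j => (hyperplanePoint p q j).2)
      * N₂ (fun j => (hyperplanePoint p q j).2)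
      * ∏ j : Fin (n + 1), f j.succ (hyperplanePoint p q j.succ)
          * W (hyperplanePoint p q j.succ)) :
    ∫⁻ p, (∫⁻ q, Y p q) ^ 2 ≤ (D * c ^ (n + 1)) ^ 2 * ∏ j : Fin (n + 1), ∫⁻ p, f j.succ p := by
  obtain ⟨j₀, hj₀⟩ := hA
  have hprod : ∀ (g : Fin (n + 2) → ℝ × ℝ → ℝ≥0∞) (s : Finset (Fin (n + 2))),
      (∀ j, Measurable (g j)) → Measurable fun x : Fin (n + 2) → ℝ × ℝ => ∏ j ∈ s, g j (x j) :=
    fun g s hg => Finset.measurable_prod _ fun j _ => (hg j).comp (measurable_pi_apply j)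
  set H₁ : (Fin (n + 2) → ℝ × ℝ) → ℝ≥0∞ := fun x => N₁ (fun j => (x j).2)
      * (∏ j ∈ Aᶜ.erase 0, f j (x j)) * ∏ j ∈ A.erase j₀, W (x j) with hH₁
  set H₂ : (Fin (n + 2) → ℝ × ℝ) → ℝ≥0∞ := fun x => N₂ (fun j => (x j).2)
      * (∏ j ∈ A, f j (x j)) * ∏ j ∈ Aᶜ.erase 0, W (x j) with hH₂
  have hm₁ : Measurable H₁ := ((hN₁.comp (by fun_prop)).mul (hprod _ _ hf)).mul
    (hprod (fun _ => W) _ fun _ => hW)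
  have hm₂ : Measurable H₂ := ((hN₂.comp (by fun_prop)).mul (hprod _ _ hf)).mul
    (hprod (fun _ => W) _ fun _ => hW)
  have hYH : ∀ p q, Y p q ^ 2 ≤ H₁ (hyperplanePoint p q) * H₂ (hyperplanePoint p q) := by
    intro p q
    refine (hY p q).trans ?_
    set x := hyperplanePoint p q
    rw [← prod_mul_prod_compl_erase_zero h0 fun j => f j (x j) * W (x j)]
    have hle : ∏ j ∈ A, W (x j) ≤ ∏ j ∈ A.erase j₀, W (x j) :=
      Finset.prod_le_prod_of_subset_of_le_one' (Finset.erase_subset _ _) fun _ _ _ => hW1 _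
    simp only [Finset.prod_mul_distrib, hH₁, hH₂]
    calc _ = N₁ (fun j => (x j).2) * (∏ j ∈ Aᶜ.erase 0, f j (x j)) * (∏ j ∈ A, W (x j))
          * (N₂ (fun j => (x j).2) * (∏ j ∈ A, f j (x j)) * ∏ j ∈ Aᶜ.erase 0, W (x j)) := by ring
      _ ≤ _ := by gcongr
  set b₁ := D * c ^ (A.erase j₀).card * ∏ j ∈ Aᶜ.erase 0, ∫⁻ p, f j p with hb₁
  have hcard : (A.erase j₀).card ≤ n + 1 ∧ (Aᶜ.erase 0).card ≤ n + 1 := by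
    have h1 := Finset.card_le_univ A
    have h2 := Finset.card_le_univ Aᶜ
    rw [Finset.card_erase_of_mem hj₀, Finset.card_erase_of_mem (by simpa using h0)]
    simp only [Fintype.card_fin] at h1 h2
    omega
  calc ∫⁻ p, (∫⁻ q, Y p q) ^ 2
      ≤ ∫⁻ p, b₁ * ∫⁻ q, H₂ (hyperplanePoint p q) := by
        refine lintegral_mono fun p => ?_
        refine (sq_lintegral_le (hm₁.comp (measurable_hyperplanePoint p))
          (hm₂.comp (measurable_hyperplanePoint p)) (hYH p)).trans ?_
        simp only [Function.comp_apply]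
        gcongr
        exact lintegral_hyperplane_le h0 hj₀ hN₁ (hD₁ j₀ hj₀) hf hW hc hm₁ hH₁ p
    _ = b₁ * ∫⁻ p, ∫⁻ q, H₂ (hyperplanePoint p q) := by
        refine lintegral_const_mul _ ?_
        refine Measurable.lintegral_prod_right' (f := fun z : (ℝ × ℝ) × (Fin n → ℝ × ℝ) =>
          H₂ (hyperplanePoint z.1 z.2)) (hm₂.comp ?_)
        exact measurable_uncurry_hyperplanePoint
    _ ≤ b₁ * (D * c ^ (Aᶜ.erase 0).card * ∏ j ∈ A, ∫⁻ p, f j p) := by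
        gcongr
        exact lintegral_lintegral_hyperplane_le h0 hN₂ (hD₂ 0 (by simpa using h0)) hf hW hc hm₂ hH₂
    _ = (D * c ^ (A.erase j₀).card) * (D * c ^ (Aᶜ.erase 0).card)
          * ∏ j : Fin (n + 1), ∫⁻ p, f j.succ p := by
        rw [hb₁, ← prod_mul_prod_compl_erase_zero h0 fun j => ∫⁻ p, f j p]
        ring
    _ ≤ _ := by
        rw [sq]
        gcongr
        · exact hcard.1
        · exact hcard.2

end Marginal

section Fourier

open Real

/-- `FT2` maps Schwartz functions to Schwartz functions. -/
lemma exists_schwartz_FT2 (v : SchwartzMap (ℝ × ℝ) ℂ) :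
    ∃ g : SchwartzMap (ℝ × ℝ) ℂ, ∀ q : ℝ × ℝ, FT2 v q.1 q.2 = g q := by
  set L := WithLp.prodContinuousLinearEquiv 2 ℝ ℝ ℝ
  set w : SchwartzMap (WithLp 2 (ℝ × ℝ)) ℂ := SchwartzMap.compCLMOfContinuousLinearEquiv ℂ L v
  have h2π : (2 * π)⁻¹ ≠ 0 := by positivity
  set S := L.symm.trans (ContinuousLinearEquiv.smulLeft (Units.mk0 _ h2π))
  refine ⟨SchwartzMap.compCLMOfContinuousLinearEquiv ℂ S (FourierTransform.fourier w), ?_⟩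
  intro q
  change _ = FourierTransform.fourier (w : WithLp 2 (ℝ × ℝ) → ℂ) (S q)
  rw [Real.fourier_eq', ← (WithLp.volume_preserving_toLp (U := ℝ) (V := ℝ)).integral_comp
    (MeasurableEquiv.toLp 2 (ℝ × ℝ)).measurableEmbedding]
  refine integral_congr_ae (Filter.Eventually.of_forall fun p => ?_)
  have hS : S q = WithLp.toLp 2 ((2 * π)⁻¹ • q) := rfl
  simp only [smul_eq_mul, hS, WithLp.prod_inner_apply]
  congr 2
  · push_cast
    simp
    field_simp

lemma wgt_le (s b : ℝ) : ∃ (C : ℝ) (n : ℕ), 0 ≤ C ∧ ∀ q : ℝ × ℝ,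
    wgt s b q.1 q.2 ≤ C * (1 + ‖q‖) ^ n := by
  have hpow : ∀ (r x y : ℝ) (m : ℕ), 1 ≤ x → 1 ≤ y → x ≤ y ^ m →
      x ^ r ≤ y ^ (m * ⌈|r|⌉₊) := by
    intro r x y m hx hy hxy
    calc x ^ r ≤ x ^ (⌈|r|⌉₊ : ℝ) :=
          Real.rpow_le_rpow_of_exponent_le hx ((le_abs_self r).trans (Nat.le_ceil _))
      _ = x ^ ⌈|r|⌉₊ := Real.rpow_natCast _ _
      _ ≤ (y ^ m) ^ ⌈|r|⌉₊ := by gcongr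
      _ = _ := (pow_mul _ _ _).symm
  refine ⟨1, 2 * ⌈|s|⌉₊ + 6 * ⌈|b|⌉₊, zero_le_one, fun q => ?_⟩
  have h1 : |q.1| ≤ ‖q‖ := norm_fst_le q
  have h2 : |q.2| ≤ ‖q‖ := norm_snd_le q
  set y := ‖q‖
  have hy : 0 ≤ y := norm_nonneg q
  rw [one_mul, pow_add, wgt]
  gcongr
  · refine hpow _ _ _ 2 (by nlinarith [sq_nonneg q.2]) (by linarith) ?_
    nlinarith [sq_abs q.2, abs_nonneg q.2]
  · refine hpow _ _ _ 6 (by nlinarith [sq_nonneg (q.1 - q.2 ^ 3)]) (by linarith) ?_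
    have h3 : |q.1 - q.2 ^ 3| ≤ y + y ^ 3 := by
      refine (abs_sub _ _).trans ?_
      rw [abs_pow]
      gcongr
    have h4 : (q.1 - q.2 ^ 3) ^ 2 ≤ (y + y ^ 3) ^ 2 := by
      rw [← sq_abs]
      gcongr
    nlinarith [pow_nonneg hy 3, pow_nonneg hy 2, pow_nonneg hy 4, pow_nonneg hy 5]

lemma measurable_wgt (s b : ℝ) : Measurable fun q : ℝ × ℝ => wgt s b q.1 q.2 := by
  unfold wgt
  fun_prop

lemma wgt_nonneg (s b τ ξ : ℝ) : 0 ≤ wgt s b τ ξ := by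
  unfold wgt
  positivity

lemma measurable_FT2 (v : SchwartzMap (ℝ × ℝ) ℂ) : Measurable fun q : ℝ × ℝ => FT2 v q.1 q.2 := by
  obtain ⟨g, hg⟩ := exists_schwartz_FT2 v
  simp_rw [hg]
  exact g.continuous.measurable

lemma integrable_wgt_FT2 (s b : ℝ) (v : SchwartzMap (ℝ × ℝ) ℂ) :
    Integrable fun q : ℝ × ℝ => wgt s b q.1 q.2 * ‖FT2 v q.1 q.2‖ ^ 2 := by
  have hm := ((measurable_wgt s b).mul ((measurable_FT2 v).norm.pow_const 2)).aestronglyMeasurable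
    (μ := volume)
  obtain ⟨g, hg⟩ := exists_schwartz_FT2 v
  obtain ⟨C, n, hC, hw⟩ := wgt_le s b
  obtain ⟨D, hD0, hD⟩ := g.decay 0 0
  simp only [pow_zero, one_mul, norm_iteratedFDeriv_zero] at hD
  replace hD0 := hD0.le
  have hdecay := g.integrable_pow_mul volume n
  have hint : Integrable fun q : ℝ × ℝ => C * D * (2 ^ n * (‖g q‖ + ‖q‖ ^ n * ‖g q‖)) :=
    ((g.integrable.norm.add hdecay).const_mul _).const_mul _
  refine hint.mono' hm (Filter.Eventually.of_forall fun q => ?_)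
  rw [hg, Real.norm_of_nonneg (mul_nonneg (wgt_nonneg _ _ _ _) (by positivity))]
  have h1 : (1 + ‖q‖) ^ n ≤ 2 ^ n * (1 + ‖q‖ ^ n) := by
    rcases le_total ‖q‖ 1 with h | h
    · calc (1 + ‖q‖) ^ n ≤ 2 ^ n := by gcongr; linarith
        _ ≤ _ := le_mul_of_one_le_right (by positivity) (by simp)
    · calc (1 + ‖q‖) ^ n ≤ (2 * ‖q‖) ^ n := by gcongr; linarith
        _ = 2 ^ n * ‖q‖ ^ n := mul_pow _ _ _
        _ ≤ _ := by gcongr; linarith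
  calc wgt s b q.1 q.2 * ‖g q‖ ^ 2 ≤ (C * (2 ^ n * (1 + ‖q‖ ^ n))) * (D * ‖g q‖) := by
        rw [pow_two]
        have := hD q
        gcongr
        exact (hw q).trans (by gcongr)
    _ = _ := by ring

lemma lintegral_wgt_FT2 (s b : ℝ) (v : SchwartzMap (ℝ × ℝ) ℂ) :
    ∫⁻ q : ℝ × ℝ, ENNReal.ofReal (wgt s b q.1 q.2 * ‖FT2 v q.1 q.2‖ ^ 2)
      = ENNReal.ofReal (Xnorm s b v ^ 2) := by
  have h0 : ∀ q : ℝ × ℝ, 0 ≤ wgt s b q.1 q.2 * ‖FT2 v q.1 q.2‖ ^ 2 := fun q =>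
    mul_nonneg (wgt_nonneg _ _ _ _) (by positivity)
  rw [Xnorm, Real.sq_sqrt (integral_nonneg h0),
    ofReal_integral_eq_lintegral_ofReal (integrable_wgt_FT2 s b v) (Filter.Eventually.of_forall h0)]

lemma integrable_modulation_weight : Integrable fun σ : ℝ => (1 + σ ^ 2) ^ (-(3 / 4) : ℝ) := by
  have := integrable_rpow_neg_one_add_norm_sq (E := ℝ) (μ := volume) (r := 3 / 2)
    (by norm_num)
  convert! this using 3 with σ
  · simp
  · norm_num

lemma lintegral_modulation_weight (ξ : ℝ) :
    ∫⁻ τ : ℝ, ENNReal.ofReal ((1 + (τ - ξ ^ 3) ^ 2) ^ (-(3 / 4) : ℝ))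
      = ENNReal.ofReal (∫ σ : ℝ, (1 + σ ^ 2) ^ (-(3 / 4) : ℝ)) := by
  rw [lintegral_sub_right_eq_self (fun σ => ENNReal.ofReal ((1 + σ ^ 2) ^ (-(3 / 4) : ℝ))),
    ofReal_integral_eq_lintegral_ofReal integrable_modulation_weight
      (Filter.Eventually.of_forall fun σ => by positivity)]

end Fourier

lemma sq_weighted_multiplier_eq {k : ℕ} {s : ℝ} {sv : Fin k → ℝ} {m m₁ m₂ : ℝ} (hm₁ : 0 ≤ m₁)
    (hm₂ : 0 ≤ m₂) {ξ : Fin k → ℝ}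
    (hfact : Real.sqrt (m₁ * m₂) =
      m * (1 + (∑ j, ξ j) ^ 2) ^ (s / 2) / ∏ j, (1 + (ξ j) ^ 2) ^ (sv j / 2))
    (b : ℝ) (τ : Fin k → ℝ) (z : Fin k → ℂ) :
    ((1 + (∑ j, ξ j) ^ 2) ^ (s / 2) * ‖(m : ℂ) * ∏ j, z j‖) ^ 2 =
      m₁ * m₂ * ∏ j, wgt (sv j) b (τ j) (ξ j) * ‖z j‖ ^ 2
        * (1 + (τ j - ξ j ^ 3) ^ 2) ^ (-b) := by
  have hpos : 0 < ∏ j, (1 + (ξ j) ^ 2) ^ (sv j / 2) :=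
    Finset.prod_pos fun j _ => by positivity
  have hsq : ∀ x r : ℝ, ((1 + x ^ 2) ^ (r / 2)) ^ 2 = (1 + x ^ 2) ^ r := fun x r => by
    rw [← Real.rpow_natCast, ← Real.rpow_mul (by positivity)]
    norm_num
  have hwgt : ∀ j, wgt (sv j) b (τ j) (ξ j) * ‖z j‖ ^ 2 * (1 + (τ j - ξ j ^ 3) ^ 2) ^ (-b)
      = ((1 + (ξ j) ^ 2) ^ (sv j / 2)) ^ 2 * ‖z j‖ ^ 2 := fun j => by
    have : (0 : ℝ) < (1 + (τ j - ξ j ^ 3) ^ 2) ^ b := by positivity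
    rw [hsq, wgt, Real.rpow_neg (by positivity)]
    field_simp
  rw [eq_div_iff hpos.ne'] at hfact
  simp_rw [hwgt]
  rw [Finset.prod_mul_distrib, Finset.prod_pow, Finset.prod_pow, norm_mul, norm_prod,
    Complex.norm_real, ← Real.sq_sqrt (mul_nonneg hm₁ hm₂), mul_pow, mul_pow, Real.norm_eq_abs,
    sq_abs]
  have := congrArg (fun x => x ^ 2 * (∏ j, ‖z j‖) ^ 2) hfact
  linear_combination -this

lemma XnormM_le_of_lintegral_le {s b R : ℝ} (hb : b ≤ 0) (hR : 0 ≤ R) {n : ℕ}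
    {M : (Fin (n + 1) → ℝ) → ℂ} {u : Fin (n + 1) → ℝ × ℝ → ℂ}
    (h : ∫⁻ p : ℝ × ℝ, (∫⁻ q : Fin n → ℝ × ℝ, ENNReal.ofReal ((1 + p.2 ^ 2) ^ (s / 2) *
      ‖M (fun j => (hyperplanePoint p q j.succ).2) * ∏ j, FT2 (u j)
        (hyperplanePoint p q j.succ).1 (hyperplanePoint p q j.succ).2‖)) ^ 2
      ≤ ENNReal.ofReal R ^ 2) :
    XnormM s b (n + 1) M u ≤ R := by
  rw [XnormM, Real.sqrt_le_left hR]
  by_cases hint : Integrable fun q : ℝ × ℝ => wgt s b q.1 q.2 * ‖convFT (n + 1) M u q.1 q.2‖ ^ 2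
  swap
  · rw [integral_undef hint]
    positivity
  have h0 : ∀ q : ℝ × ℝ, 0 ≤ wgt s b q.1 q.2 * ‖convFT (n + 1) M u q.1 q.2‖ ^ 2 := fun q =>
    mul_nonneg (wgt_nonneg _ _ _ _) (by positivity)
  rw [← ENNReal.ofReal_le_ofReal_iff (by positivity),
    ofReal_integral_eq_lintegral_ofReal hint (.of_forall h0), ENNReal.ofReal_pow hR]
  refine (lintegral_mono fun p => ?_).trans h
  simp_rw [ENNReal.ofReal_mul (show (0 : ℝ) ≤ (1 + p.2 ^ 2) ^ (s / 2) by positivity)]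
  rw [lintegral_const_mul' _ _ ENNReal.ofReal_ne_top]
  calc ENNReal.ofReal (wgt s b p.1 p.2 * ‖convFT (n + 1) M u p.1 p.2‖ ^ 2)
      ≤ ENNReal.ofReal (((1 + p.2 ^ 2) ^ (s / 2) * ‖convFT (n + 1) M u p.1 p.2‖) ^ 2) := by
        refine ENNReal.ofReal_le_ofReal ?_
        rw [mul_pow, ← Real.rpow_natCast ((1 + p.2 ^ 2) ^ (s / 2)), ← Real.rpow_mul (by positivity)]
        gcongr
        rw [wgt]
        norm_num
        refine mul_le_of_le_one_right (by positivity) ?_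
        exact Real.rpow_le_one_of_one_le_of_nonpos (by nlinarith [sq_nonneg (p.1 - p.2 ^ 3)]) hb
    _ ≤ _ := by
        rw [ENNReal.ofReal_pow (by positivity), ENNReal.ofReal_mul (by positivity),
          ofReal_norm]
        gcongr
        refine (enorm_integral_le_lintegral_enorm _).trans_eq ?_
        refine lintegral_congr fun q => ?_
        rw [ofReal_norm]
        rfl

lemma exists_XnormM_le_of_zero_notMem {k : ℕ} (hk : 2 ≤ k) (s : ℝ) (sv : Fin k → ℝ)
    (M : (Fin k → ℝ) → ℝ)
    (A : Finset (Fin (k + 1))) (hA : A.Nonempty) (h0 : 0 ∉ A)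
    (M₁ M₂ : (Fin k → ℝ) → ℝ) (hM₁meas : Measurable M₁) (hM₂meas : Measurable M₂)
    (hM₁pos : ∀ ξ, 0 ≤ M₁ ξ) (hM₂pos : ∀ ξ, 0 ≤ M₂ ξ)
    (C₀ θ : ℝ) (hC₀ : 0 < C₀)
    (hfact : ∀ ξ : Fin k → ℝ,
      Real.sqrt (M₁ ξ * M₂ ξ) =
        M ξ * (1 + (∑ j, ξ j) ^ 2) ^ (s / 2) / ∏ j, (1 + (ξ j) ^ 2) ^ (sv j / 2))
    (hFR₁ : FreqRestricted k M₁ A C₀ θ)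
    (hFR₂ : FreqRestricted k M₂ Aᶜ C₀ θ) :
    ∃ b b' C : ℝ, 1/2 < b ∧ b < 1 ∧ b - 1 < b' ∧ b' < 0 ∧ 0 < C ∧
      ∀ K : ℝ, 0 < K → ∀ v : Fin k → SchwartzMap (ℝ × ℝ) ℂ,
        XnormM s b' k (fun ξ => if |PhiK k ξ| < K then (M ξ : ℂ) else 0)
            (fun j => ⇑(v j)) ≤
          C * K ^ θ * ∏ j, Xnorm (sv j) b ⇑(v j) := by
  obtain ⟨n, rfl⟩ : ∃ n, k = n + 1 := ⟨k - 1, by omega⟩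
  set c : ℝ := max 1 (∫ σ : ℝ, (1 + σ ^ 2) ^ (-(3 / 4) : ℝ)) with hc_def
  have hc1 : 1 ≤ c := le_max_left _ _
  refine ⟨3 / 4, -(1 / 8), C₀ * c ^ (n + 1), by norm_num, by norm_num, by norm_num, by norm_num,
    by positivity, fun K hK v => ?_⟩
  have hX : ∀ j, 0 ≤ Xnorm (sv j) (3 / 4) (v j) := fun j => Real.sqrt_nonneg _
  refine XnormM_le_of_lintegral_le (by norm_num)
    (mul_nonneg (by positivity) (Finset.prod_nonneg fun j _ => hX j)) ?_
  set N : ((Fin (n + 1) → ℝ) → ℝ) → (Fin (n + 2) → ℝ) → ENNReal := fun M' η =>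
    ENNReal.ofReal (M' (tailVec (n + 1) η) * if |PhiFull (n + 1) η - 0| < K then 1 else 0) with hN
  have hNmeas : ∀ {M'}, Measurable M' → Measurable (N M') := fun {M'} hM' => by
    have hΦ : Measurable fun η : Fin (n + 2) → ℝ => |PhiFull (n + 1) η - 0| := by
      unfold PhiFull
      fun_prop
    have ht : Measurable fun η : Fin (n + 2) → ℝ => tailVec (n + 1) η := by
      unfold tailVec
      fun_prop
    exact ((hM'.comp ht).mul (Measurable.ite (measurableSet_lt hΦ measurable_const)
      measurable_const measurable_const)).ennreal_ofReal
  set f : Fin (n + 2) → ℝ × ℝ → ENNReal := Fin.cons (fun _ => 1) fun j p =>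
    ENNReal.ofReal (wgt (sv j) (3 / 4) p.1 p.2 * ‖FT2 (v j) p.1 p.2‖ ^ 2) with hf_def
  have hf : ∀ j, Measurable (f j) := Fin.cases measurable_const fun j =>
    ((measurable_wgt _ _).mul ((measurable_FT2 (v j)).norm.pow_const 2)).ennreal_ofReal
  set W : ℝ × ℝ → ENNReal := fun p =>
    ENNReal.ofReal ((1 + (p.1 - p.2 ^ 3) ^ 2) ^ (-(3 / 4) : ℝ)) with hW_def
  have key := lintegral_sq_hyperplane_le (n := n) hA h0 (hNmeas hM₁meas) (hNmeas hM₂meas)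
    (D := ENNReal.ofReal (C₀ * K ^ θ)) (c := ENNReal.ofReal c) (by simpa using hc1)
    (hFR₁ K hK 0) (hFR₂ K hK 0) hf (W := W) (by unfold W; fun_prop)
    (fun p => by
      rw [hW_def, ENNReal.ofReal_le_one]
      exact Real.rpow_le_one_of_one_le_of_nonpos (by nlinarith [sq_nonneg (p.1 - p.2 ^ 3)])
        (by norm_num))
    (fun ξ => (lintegral_modulation_weight ξ).trans_le
      (ENNReal.ofReal_le_ofReal (le_max_right _ _)))
    (Y := fun p q => ENNReal.ofReal ((1 + p.2 ^ 2) ^ (s / 2) *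
      ‖(if |PhiK (n + 1) (fun j => (hyperplanePoint p q j.succ).2)| < K then
          (M (fun j => (hyperplanePoint p q j.succ).2) : ℂ) else 0) * ∏ j, FT2 (v j)
        (hyperplanePoint p q j.succ).1 (hyperplanePoint p q j.succ).2‖))
    (fun p q => ?_)
  · refine key.trans_eq ?_
    have hprod : ∏ j : Fin (n + 1), ∫⁻ p, f j.succ p
        = ENNReal.ofReal (∏ j, Xnorm (sv j) (3 / 4) (v j)) ^ 2 := by
      rw [ENNReal.ofReal_prod_of_nonneg fun j _ => hX j, ← Finset.prod_pow]
      refine Finset.prod_congr rfl fun j _ => ?_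
      rw [← ENNReal.ofReal_pow (hX j), ← lintegral_wgt_FT2]
      rfl
    rw [hprod, ← mul_pow, ← ENNReal.ofReal_pow (by positivity),
      ← ENNReal.ofReal_mul (by positivity), ← ENNReal.ofReal_mul (by positivity)]
    congr 3
    ring
  · set x := hyperplanePoint p q with hx
    have hsum : p.2 = ∑ j : Fin (n + 1), (x j.succ).2 := by
      rw [← Prod.snd_sum, ← hyperplanePoint_zero_eq_sum]
      rfl
    have hΦ : PhiFull (n + 1) (fun j => (x j).2) - 0 = PhiK (n + 1) fun j => (x j.succ).2 := by
      rw [sub_zero, PhiFull, PhiK, ← hsum]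
      rfl
    by_cases hlt : |PhiK (n + 1) fun j => (x j.succ).2| < K
    swap
    · simp [hlt]
    have h := sq_weighted_multiplier_eq (hM₁pos _) (hM₂pos _) (hfact fun j => (x j.succ).2) (3 / 4)
      (fun j => (x j.succ).1) (fun j => FT2 (v j) (x j.succ).1 (x j.succ).2)
    rw [← hsum] at h
    have hw : ∀ j : Fin (n + 1), 0 ≤ wgt (sv j) (3 / 4) (x j.succ).1 (x j.succ).2
        * ‖FT2 (v j) (x j.succ).1 (x j.succ).2‖ ^ 2 := fun j =>
      mul_nonneg (wgt_nonneg _ _ _ _) (by positivity)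
    refine le_of_eq ?_
    rw [if_pos hlt, ← ENNReal.ofReal_pow (by positivity), h, ENNReal.ofReal_mul
      (mul_nonneg (hM₁pos _) (hM₂pos _)), ENNReal.ofReal_mul (hM₁pos _),
      ENNReal.ofReal_prod_of_nonneg fun j _ => mul_nonneg (hw j) (by positivity)]
    simp only [hN, hΦ, if_pos hlt, mul_one]
    congr 1
    refine Finset.prod_congr rfl fun j _ => ?_
    rw [ENNReal.ofReal_mul (hw j)]
    rfl

theorem freq_restricted_to_bourgain_low_resonance
    (k : ℕ) (hk : 2 ≤ k) (s : ℝ) (sv : Fin k → ℝ)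
    (M : (Fin k → ℝ) → ℝ) (hMmeas : Measurable M) (hMpos : ∀ ξ, 0 ≤ M ξ)
    (hMpoly : ∃ (C' : ℝ) (p : ℕ), ∀ ξ, |M ξ| ≤ C' * (1 + ‖ξ‖) ^ p)
    (A : Finset (Fin (k + 1))) (hA : A.Nonempty) (hA' : A ≠ Finset.univ)
    (M₁ M₂ : (Fin k → ℝ) → ℝ) (hM₁meas : Measurable M₁) (hM₂meas : Measurable M₂)
    (hM₁pos : ∀ ξ, 0 ≤ M₁ ξ) (hM₂pos : ∀ ξ, 0 ≤ M₂ ξ)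
    (C₀ θ : ℝ) (hC₀ : 0 < C₀) (hθ : 0 < θ) (hθ1 : θ < 1)
    (hfact : ∀ ξ : Fin k → ℝ,
      Real.sqrt (M₁ ξ * M₂ ξ) =
        M ξ * (1 + (∑ j, ξ j) ^ 2) ^ (s / 2) / ∏ j, (1 + (ξ j) ^ 2) ^ (sv j / 2))
    (hFR₁ : FreqRestricted k M₁ A C₀ θ)
    (hFR₂ : FreqRestricted k M₂ Aᶜ C₀ θ) :
    ∃ b b' C : ℝ, 1/2 < b ∧ b < 1 ∧ b - 1 < b' ∧ b' < 0 ∧ 0 < C ∧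
      ∀ K : ℝ, 0 < K → ∀ v : Fin k → SchwartzMap (ℝ × ℝ) ℂ,
        XnormM s b' k (fun ξ => if |PhiK k ξ| < K then (M ξ : ℂ) else 0)
            (fun j => ⇑(v j)) ≤
          C * K ^ θ * ∏ j, Xnorm (sv j) b ⇑(v j) := by
  by_cases h0 : (0 : Fin (k + 1)) ∈ A
  · exact exists_XnormM_le_of_zero_notMem hk s sv M Aᶜ
      (Finset.nonempty_iff_ne_empty.mpr (by simpa using hA'))
      (by simpa using h0) M₂ M₁ hM₂meas hM₁meas hM₂pos hM₁pos C₀ θ hC₀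
      (fun ξ => by rw [mul_comm, hfact]) hFR₂ (by rwa [compl_compl])
  · exact exists_XnormM_le_of_zero_notMem hk s sv M A hA h0 M₁ M₂ hM₁meas hM₂meas hM₁pos hM₂pos
      C₀ θ hC₀ hfact hFR₁ hFR₂

end
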